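/- Let $G=(V,E)$ be a finite connected simple graph with at least two vertices, $m$ edges and minimum degree $d$. Let $P$ be the transition matrix of the lazy random walk on $G$, i.e. $P(u,u)=\tfrac12$, $P(u,v)=\tfrac{1}{2\deg(u)}$ if $\{u,v\}\in E$, and $P(u,v)=0$ otherwise, and let $g_t(x,x)=\sum_{i=0}^{t-1}P^i(x,x)$ be its Green's function. Then for every vertex $x\in V$ and every integer $t$ with $1\le t\le \frac{36m^2}{d^2}$, $$g_t(x,x)\le \frac{6\deg(x)\sqrt{t}}{d}.$$ -/

import Mathlib

/-- The transition matrix of the lazy random walk on `G`: stay put with probability `1/2`,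
otherwise move to a uniformly chosen neighbour. -/
noncomputable def lazyP {V : Type*} [DecidableEq V] [Fintype V] (G : SimpleGraph V)
    [DecidableRel G.Adj] : Matrix V V ℝ :=
  fun u v =>
    if u = v then 1 / 2
    else if G.Adj u v then 1 / (2 * (G.degree u : ℝ)) else 0

/-- The Green's function `g_t(x, u) = ∑_{i=0}^{t-1} P^i(x, u)`. -/
noncomputable def green {V : Type*} [DecidableEq V] [Fintype V] (P : Matrix V V ℝ)
    (t : ℕ) (x u : V) : ℝ :=
  ∑ i ∈ Finset.range t, (P ^ i) x u

/-- A sum over ordered pairs of adjacent vertices of a symmetric function is twice the sum over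
edges. -/
lemma SimpleGraph.sum_sum_adj_eq_two_mul_sum_edgeFinset {V : Type*} [Fintype V] [DecidableEq V]
    (G : SimpleGraph V) [DecidableRel G.Adj] (φ : Sym2 V → ℝ) :
    (∑ i, ∑ j, if G.Adj i j then φ s(i, j) else 0) = 2 * ∑ e ∈ G.edgeFinset, φ e := by
  have h1 : (∑ i, ∑ j, if G.Adj i j then φ s(i, j) else 0) = ∑ a : G.Dart, φ a.edge := by
    rw [← Fintype.sum_prod_type' (fun i j => if G.Adj i j then φ s(i, j) else 0),
      ← Finset.sum_filter]
    refine Finset.sum_bij' (fun q hq => (⟨q, (Finset.mem_filter.1 hq).2⟩ : G.Dart))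
      (fun a _ => a.toProd) ?_ ?_ ?_ ?_ ?_
    · simp
    · intro a _
      simp
    · simp
    · simp
    · intro a _
      rfl
  rw [h1, ← Finset.sum_fiberwise_of_maps_to (t := G.edgeFinset)
    (fun a _ => G.mem_edgeFinset.2 a.edge_mem), Finset.mul_sum]
  refine Finset.sum_congr rfl fun e he => ?_
  have hcard := G.dart_edge_fiber_card e (G.mem_edgeFinset.1 he)
  rw [Finset.sum_congr rfl (fun a ha => by rw [(Finset.mem_filter.1 ha).2]),
    Finset.sum_const, hcard]
  simp

/-- The squared increment of `f` along an unordered pair. -/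
def gradSq {V : Type*} (f : V → ℝ) : Sym2 V → ℝ :=
  Sym2.lift ⟨fun a b => (f a - f b) ^ 2, fun a b => by ring⟩

lemma gradSq_mk {V : Type*} (f : V → ℝ) (a b : V) : gradSq f s(a, b) = (f a - f b) ^ 2 := rfl

lemma gradSq_nonneg {V : Type*} (f : V → ℝ) (e : Sym2 V) : 0 ≤ gradSq f e := by
  induction e with
  | _ a b => rw [gradSq_mk]; positivity

open Matrix in
/-- The quadratic form of the Laplacian is the sum of the squared increments over the edges. -/
lemma SimpleGraph.dotProduct_lapMatrix_mulVec {V : Type*} [Fintype V] [DecidableEq V]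
    (G : SimpleGraph V) [DecidableRel G.Adj] (f : V → ℝ) :
    f ⬝ᵥ (G.lapMatrix ℝ *ᵥ f) = ∑ e ∈ G.edgeFinset, gradSq f e := by
  have h := G.lapMatrix_toLinearMap₂' ℝ f
  have h2 := G.sum_sum_adj_eq_two_mul_sum_edgeFinset (gradSq f)
  simp only [gradSq_mk] at h2
  rw [toLinearMap₂'_apply', h2] at h
  linarith

/-- Along a walk, each step loses at most `c` plus `1/(4c)` times its squared increment. -/
lemma SimpleGraph.Walk.sub_le_length_mul_add {V : Type*} {G : SimpleGraph V} (f : V → ℝ) {c : ℝ}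
    (hc : 0 < c) {u v : V} (p : G.Walk u v) :
    f u - f v ≤ p.length * c + (p.edges.map (gradSq f)).sum / (4 * c) := by
  induction p with
  | nil => simp
  | @cons a b w h p ih =>
    have key : f a - f b ≤ c + (f a - f b) ^ 2 / (4 * c) := by
      rw [← sub_le_iff_le_add', le_div_iff₀ (by positivity)]
      nlinarith [sq_nonneg (f a - f b - 2 * c)]
    simp only [SimpleGraph.Walk.length_cons, SimpleGraph.Walk.edges_cons, List.map_cons,
      List.sum_cons, gradSq_mk, add_div]
    push_cast
    linarith

open Matrix in
/-- The drop of `f` between two vertices is controlled by their distance and the energy of `f`. -/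
lemma SimpleGraph.Connected.sub_le_dist_mul_add {V : Type*} [Fintype V] [DecidableEq V]
    {G : SimpleGraph V} [DecidableRel G.Adj] (hG : G.Connected) (f : V → ℝ) {c : ℝ}
    (hc : 0 < c) (u v : V) :
    f u - f v ≤ G.dist u v * c + (f ⬝ᵥ (G.lapMatrix ℝ *ᵥ f)) / (4 * c) := by
  obtain ⟨p, hp, hl⟩ := hG.exists_path_of_dist u v
  refine (p.sub_le_length_mul_add f hc).trans ?_
  rw [hl, G.dotProduct_lapMatrix_mulVec]
  gcongr
  rw [← List.sum_toFinset _ hp.isTrail.edges_nodup]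
  refine Finset.sum_le_sum_of_subset_of_nonneg (fun e he => ?_) fun e _ _ => gradSq_nonneg f e
  exact G.mem_edgeFinset.2 (p.edges_subset_edgeSet (List.mem_toFinset.1 he))

/-- Every distance up to that of `y` is realised. -/
lemma SimpleGraph.Connected.exists_dist_eq {V : Type*} {G : SimpleGraph V} (hG : G.Connected)
    (x y : V) {r : ℕ} (hr : r ≤ G.dist x y) : ∃ z, G.dist x z = r := by
  obtain ⟨p, hp⟩ := hG.exists_walk_length_eq_dist x y
  refine ⟨p.getVert r, le_antisymm ?_ ?_⟩
  · have := SimpleGraph.dist_le (p.take r)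
    rw [SimpleGraph.Walk.take_length] at this
    omega
  · have h1 := SimpleGraph.dist_le (p.drop r)
    rw [SimpleGraph.Walk.drop_length] at h1
    have h2 := hG.dist_triangle (u := x) (v := p.getVert r) (w := y)
    omega

/-- Neighbourhoods of vertices whose distances to `x` differ by at least three are disjoint. -/
lemma SimpleGraph.Connected.disjoint_neighborFinset {V : Type*} [Fintype V]
    {G : SimpleGraph V} [DecidableRel G.Adj] (hG : G.Connected) {x a b : V}
    (h : G.dist x a + 3 ≤ G.dist x b) :
    Disjoint (G.neighborFinset a) (G.neighborFinset b) := by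
  rw [Finset.disjoint_left]
  intro v hva hvb
  rw [SimpleGraph.mem_neighborFinset] at hva hvb
  have h1 := SimpleGraph.dist_eq_one_iff_adj.2 hva
  have h2 := SimpleGraph.dist_eq_one_iff_adj.2 hvb.symm
  have h3 := hG.dist_triangle (u := x) (v := a) (w := b)
  have h4 := hG.dist_triangle (u := a) (v := v) (w := b)
  omega

section LazyWalk

variable {V : Type*} [Fintype V] [DecidableEq V] (G : SimpleGraph V) [DecidableRel G.Adj]

lemma lazyP_nonneg (u v : V) : 0 ≤ lazyP G u v := by
  unfold lazyP
  split_ifs <;> positivity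

lemma lazyP_pow_nonneg (i : ℕ) (u v : V) : 0 ≤ (lazyP G ^ i) u v := by
  induction i generalizing v with
  | zero => rw [pow_zero, Matrix.one_apply]; split_ifs <;> norm_num
  | succ i ih =>
    rw [pow_succ, Matrix.mul_apply]
    exact Finset.sum_nonneg fun w _ => mul_nonneg (ih w) (lazyP_nonneg G w v)

lemma degree_mul_one_sub_lazyP {u : V} (hu : 0 < G.degree u) (v : V) :
    2 * (G.degree u * (1 - lazyP G) u v) = G.lapMatrix ℝ u v := by
  have hu' : (G.degree u : ℝ) ≠ 0 := by positivity
  simp only [SimpleGraph.lapMatrix, SimpleGraph.degMatrix, Matrix.sub_apply, Matrix.one_apply,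
    Matrix.diagonal_apply, SimpleGraph.adjMatrix_apply, lazyP]
  by_cases h : u = v
  · subst h
    simp
    ring
  · by_cases h' : G.Adj u v
    · simp [h, h']
      field_simp
    · simp [h, h']

open Matrix in
lemma degree_vecMul_lazyP (hdeg : ∀ u, 0 < G.degree u) :
    (fun u => (G.degree u : ℝ)) ᵥ* lazyP G = fun u => (G.degree u : ℝ) := by
  have h : (fun u => (G.degree u : ℝ)) ᵥ* (1 - lazyP G) = 0 := by
    ext v
    have h0 : ((fun _ => (1 : ℝ)) ᵥ* G.lapMatrix ℝ) v = 0 := by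
      rw [← Matrix.mulVec_transpose, (G.isSymm_lapMatrix ℝ).eq,
        G.lapMatrix_mulVec_const_eq_zero]
      rfl
    simp only [Matrix.vecMul, dotProduct, one_mul] at h0 ⊢
    simp only [← degree_mul_one_sub_lazyP G (hdeg _), ← Finset.mul_sum] at h0
    simpa using h0
  rw [Matrix.vecMul_sub, Matrix.vecMul_one, sub_eq_zero] at h
  exact h.symm

open Matrix in
lemma degree_vecMul_lazyP_pow (hdeg : ∀ u, 0 < G.degree u) (i : ℕ) :
    (fun u => (G.degree u : ℝ)) ᵥ* (lazyP G ^ i) = fun u => (G.degree u : ℝ) := by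
  induction i with
  | zero => simp
  | succ i ih => rw [pow_succ, ← Matrix.vecMul_vecMul, ih, degree_vecMul_lazyP G hdeg]

lemma sum_degree_mul_green (hdeg : ∀ u, 0 < G.degree u) (t : ℕ) (x : V) :
    ∑ u, (G.degree u : ℝ) * green (lazyP G) t u x = t * G.degree x := by
  simp only [green, Finset.mul_sum]
  rw [Finset.sum_comm]
  have h : ∀ i ∈ Finset.range t,
      ∑ u, (G.degree u : ℝ) * (lazyP G ^ i) u x = G.degree x := fun i _ =>
    congrFun (degree_vecMul_lazyP_pow G hdeg i) x
  rw [Finset.sum_congr rfl h]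
  simp

open Matrix in
lemma lapMatrix_mulVec_green (hdeg : ∀ u, 0 < G.degree u) (t : ℕ) (x u : V) :
    (G.lapMatrix ℝ *ᵥ fun v => green (lazyP G) t v x) u
      = 2 * G.degree u * ((1 : Matrix V V ℝ) u x - (lazyP G ^ t) u x) := by
  have h := congrFun (congrFun (mul_neg_geom_sum (lazyP G) t) u) x
  rw [Matrix.mul_apply, Matrix.sub_apply] at h
  rw [← h, Matrix.mulVec, dotProduct, Finset.mul_sum]
  refine Finset.sum_congr rfl fun v _ => ?_
  rw [← degree_mul_one_sub_lazyP G (hdeg u), green, Matrix.sum_apply]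
  ring

open Matrix in
lemma lapMatrix_mulVec_green_sub_const (hdeg : ∀ u, 0 < G.degree u) (t : ℕ) (x u : V) (c : ℝ) :
    (G.lapMatrix ℝ *ᵥ fun v => green (lazyP G) t v x - c) u
      = 2 * G.degree u * ((1 : Matrix V V ℝ) u x - (lazyP G ^ t) u x) := by
  rw [← lapMatrix_mulVec_green G hdeg, SimpleGraph.lapMatrix_mulVec_apply,
    SimpleGraph.lapMatrix_mulVec_apply, Finset.sum_sub_distrib]
  simp
  ring

end LazyWalk

section Superlevel

variable {V : Type*} [Fintype V] [DecidableEq V] {G : SimpleGraph V} [DecidableRel G.Adj]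

open Matrix in
/-- The degree-weighted mass of `f` on the neighbourhood of `u`. -/
lemma minDegree_mul_le_sum_neighborFinset {f : V → ℝ} (hf : ∀ v, 0 ≤ f v) (u : V) :
    (G.minDegree : ℝ) * (G.degree u * f u - (G.lapMatrix ℝ *ᵥ f) u)
      ≤ ∑ v ∈ G.neighborFinset u, (G.degree v : ℝ) * f v := by
  rw [SimpleGraph.lapMatrix_mulVec_apply, sub_sub_cancel, Finset.mul_sum]
  refine Finset.sum_le_sum fun v _ => mul_le_mul_of_nonneg_right ?_ (hf v)
  exact_mod_cast G.minDegree_le_degree v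

lemma floor_sum_lower_bound {b : ℝ} (hb : 0 ≤ b) :
    (b ^ 2 - b) / 2 ≤ ∑ k ∈ Finset.range ⌊b⌋₊, (b - ((k : ℝ) + 1)) := by
  have hsum : ∀ n : ℕ, ∑ k ∈ Finset.range n, (b - ((k : ℝ) + 1))
      = n * b - n * (n + 1) / 2 := by
    intro n
    induction n with
    | zero => simp
    | succ n ih => rw [Finset.sum_range_succ, ih]; push_cast; ring
  rw [hsum]
  have h1 := Nat.floor_le hb
  have h2 := Nat.lt_floor_add_one b
  nlinarith [mul_nonneg (sub_nonneg.2 h1) (sub_nonneg.2 h2.le)]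

open Matrix in
/-- A nonnegative function that vanishes somewhere, is subharmonic away from `x` and has a source
of strength at most `2 deg x` at `x`, has large degree-weighted mass. -/
lemma mass_lower_bound [Nontrivial V] (hG : G.Connected) {f : V → ℝ} {x y : V}
    (hf : ∀ v, 0 ≤ f v) (hy : f y = 0)
    (hsub : ∀ u, u ≠ x → (G.lapMatrix ℝ *ᵥ f) u ≤ 0)
    (hx : (G.lapMatrix ℝ *ᵥ f) x ≤ 2 * G.degree x) (hfx : 8 / 3 ≤ f x) :
    (G.minDegree : ℝ) ^ 2 * f x ^ 2 / (24 * G.degree x) ≤ ∑ v, (G.degree v : ℝ) * f v := by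
  set D : ℝ := (G.degree x : ℝ) with hD
  set d : ℝ := (G.minDegree : ℝ) with hd
  set F : ℝ := f x with hF
  have hd0 : 0 < d := by
    have := hG.preconnected.minDegree_pos_of_nontrivial
    rw [hd]; exact_mod_cast this
  have hdD : ∀ v, d ≤ G.degree v := fun v => by
    rw [hd]; exact_mod_cast G.minDegree_le_degree v
  have hD0 : 0 < D := hd0.trans_le (hdD x)
  have hF0 : 0 ≤ F := hf x
  have henergy : f ⬝ᵥ (G.lapMatrix ℝ *ᵥ f) ≤ 2 * D * F := by
    rw [dotProduct, ← Finset.add_sum_erase _ _ (Finset.mem_univ x)]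
    have h1 : f x * (G.lapMatrix ℝ *ᵥ f) x ≤ F * (2 * D) := by gcongr
    have h2 : ∑ u ∈ Finset.univ.erase x, f u * (G.lapMatrix ℝ *ᵥ f) u ≤ 0 :=
      Finset.sum_nonpos fun u hu =>
        mul_nonpos_of_nonneg_of_nonpos (hf u) (hsub u (Finset.ne_of_mem_erase hu))
    linarith
  have hdrop : ∀ v, F / 2 - G.dist x v * D ≤ f v := by
    intro v
    have h1 := hG.sub_le_dist_mul_add f hD0 x v
    have h2 : (f ⬝ᵥ (G.lapMatrix ℝ *ᵥ f)) / (4 * D) ≤ F / 2 := by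
      rw [div_le_iff₀ (by positivity)]; linarith
    linarith
  set b : ℝ := F / (6 * D) with hb
  have hb0 : 0 ≤ b := by positivity
  have hbF : 6 * D * b = F := by rw [hb]; field_simp
  have hK := Nat.floor_le hb0
  set K := ⌊b⌋₊ with hKdef
  have hdist : 3 * K ≤ G.dist x y := by
    have h1 := hdrop y
    rw [hy] at h1
    have h2 : 3 * b ≤ G.dist x y := by
      refine le_of_mul_le_mul_right ?_ hD0
      linarith
    have h3 : ((3 * K : ℕ) : ℝ) ≤ G.dist x y := by push_cast; linarith
    exact_mod_cast h3
  have hex : ∀ k : ℕ, ∃ z, k ≤ K → G.dist x z = 3 * k := by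
    intro k
    by_cases hk : k ≤ K
    · obtain ⟨z, hz⟩ := hG.exists_dist_eq x y (r := 3 * k) (by omega)
      exact ⟨z, fun _ => hz⟩
    · exact ⟨x, fun h => absurd h hk⟩
  choose z hz using hex
  have hz0 : z 0 = x := (hG.dist_eq_zero_iff.1 (by simpa using hz 0 (Nat.zero_le _))).symm
  have hdisj : Set.PairwiseDisjoint (Finset.range (K + 1) : Set ℕ)
      (fun k => G.neighborFinset (z k)) := by
    intro i hi j hj hij
    simp only [Finset.coe_range, Set.mem_Iio] at hi hj
    have h1 := hz i (by omega)
    have h2 := hz j (by omega)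
    rcases lt_or_gt_of_ne hij with h | h
    · exact hG.disjoint_neighborFinset (x := x) (by omega)
    · exact (hG.disjoint_neighborFinset (x := x) (by omega)).symm
  have hmass : ∑ k ∈ Finset.range (K + 1), ∑ v ∈ G.neighborFinset (z k), (G.degree v : ℝ) * f v
      ≤ ∑ v, (G.degree v : ℝ) * f v := by
    rw [← Finset.sum_biUnion hdisj]
    exact Finset.sum_le_sum_of_subset_of_nonneg (Finset.subset_univ _)
      fun v _ _ => mul_nonneg (Nat.cast_nonneg _) (hf v)
  have hsource : d * (D * (F - 2)) ≤ ∑ v ∈ G.neighborFinset (z 0), (G.degree v : ℝ) * f v := by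
    rw [hz0]
    refine le_trans ?_ (minDegree_mul_le_sum_neighborFinset hf x)
    gcongr
    linarith
  have hlayer : ∀ k ∈ Finset.range K, d ^ 2 * (3 * D) * (b - ((k : ℝ) + 1))
      ≤ ∑ v ∈ G.neighborFinset (z (k + 1)), (G.degree v : ℝ) * f v := by
    intro k hk
    have hk' := hz (k + 1) (by simpa using hk)
    have hne : z (k + 1) ≠ x := by
      intro h
      rw [h, SimpleGraph.dist_self] at hk'
      omega
    have h1 := hdrop (z (k + 1))
    rw [hk'] at h1
    push_cast at h1
    refine le_trans ?_ (minDegree_mul_le_sum_neighborFinset hf _)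
    have h2 : d * f (z (k + 1)) ≤ G.degree (z (k + 1)) * f (z (k + 1)) :=
      mul_le_mul_of_nonneg_right (hdD _) (hf _)
    have h3 : d * (3 * D * (b - ((k : ℝ) + 1))) ≤ d * f (z (k + 1)) := by
      gcongr
      linarith
    rw [pow_two, mul_assoc, mul_assoc]
    gcongr
    linarith [hsub _ hne]
  rw [Finset.sum_range_succ'] at hmass
  have hsum := Finset.sum_le_sum hlayer
  rw [← Finset.mul_sum] at hsum
  have hfl : d ^ 2 * (3 * D) * ((b ^ 2 - b) / 2)
      ≤ d ^ 2 * (3 * D) * ∑ k ∈ Finset.range K, (b - ((k : ℝ) + 1)) := by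
    gcongr
    exact floor_sum_lower_bound hb0
  have heq : d ^ 2 * (3 * D) * ((b ^ 2 - b) / 2)
      = d ^ 2 * F ^ 2 / (24 * D) - d * (d * (F / 4)) := by
    rw [hb]; field_simp; ring
  have hcmp : d * (d * (F / 4)) ≤ d * (D * (F - 2)) := by
    have := hdD x
    have h1 : d * (F / 4) ≤ D * (F / 4) := by gcongr
    have h2 : D * (F / 4) ≤ D * (F - 2) := by gcongr; linarith
    exact mul_le_mul_of_nonneg_left (h1.trans h2) hd0.le
  linarith

end Superlevel

open Matrix in
/-- For a finite connected graph `G` with `m` edges and minimum degree `d`,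
every vertex `x` and every `1 ≤ t ≤ 36 m² / d²`: `g_t(x,x) ≤ 6 deg(x) √t / d`. -/
theorem green_function_bound
    {V : Type*} [Fintype V] [DecidableEq V] [Nontrivial V]
    (G : SimpleGraph V) [DecidableRel G.Adj] (hG : G.Connected)
    (x : V) (t : ℕ) (ht1 : 1 ≤ t)
    (ht2 : (t : ℝ) ≤ 36 * (G.edgeFinset.card : ℝ) ^ 2 / (G.minDegree : ℝ) ^ 2) :
    green (lazyP G) t x x ≤
      6 * (G.degree x : ℝ) * Real.sqrt (t : ℝ) / (G.minDegree : ℝ) := by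
  have hdeg : ∀ u, 0 < G.degree u := fun u => hG.preconnected.degree_pos_of_nontrivial u
  have hd0 : (0 : ℝ) < G.minDegree := by
    exact_mod_cast hG.preconnected.minDegree_pos_of_nontrivial
  have hdD : (G.minDegree : ℝ) ≤ G.degree x := by exact_mod_cast G.minDegree_le_degree x
  obtain ⟨y, -, hy⟩ := Finset.exists_min_image Finset.univ
    (fun u => green (lazyP G) t u x) ⟨x, Finset.mem_univ x⟩
  set μ := green (lazyP G) t y x with hμ
  set f : V → ℝ := fun v => green (lazyP G) t v x - μ with hf
  have hf0 : ∀ v, 0 ≤ f v := fun v => sub_nonneg.2 (hy v (Finset.mem_univ v))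
  have hμ0 : 0 ≤ μ := Finset.sum_nonneg fun i _ => lazyP_pow_nonneg G i y x
  have hlap : ∀ u, (G.lapMatrix ℝ *ᵥ f) u
      = 2 * G.degree u * ((1 : Matrix V V ℝ) u x - (lazyP G ^ t) u x) := fun u =>
    lapMatrix_mulVec_green_sub_const G hdeg t x u μ
  have hsub : ∀ u, u ≠ x → (G.lapMatrix ℝ *ᵥ f) u ≤ 0 := by
    intro u hu
    rw [hlap, Matrix.one_apply_ne hu, zero_sub, mul_neg, neg_nonpos]
    have := lazyP_pow_nonneg G t u x
    positivity
  have hsource : (G.lapMatrix ℝ *ᵥ f) x ≤ 2 * G.degree x := by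
    rw [hlap, Matrix.one_apply_eq]
    have := lazyP_pow_nonneg G t x x
    exact mul_le_of_le_one_right (by positivity) (by linarith)
  have hvol : ∑ u, (G.degree u : ℝ) = 2 * G.edgeFinset.card := by
    exact_mod_cast G.sum_degrees_eq_twice_card_edges
  have htotal : ∑ u, (G.degree u : ℝ) * f u + 2 * G.edgeFinset.card * μ = t * G.degree x := by
    rw [← sum_degree_mul_green G hdeg t x, ← hvol, Finset.sum_mul, ← Finset.sum_add_distrib]
    refine Finset.sum_congr rfl fun u _ => ?_
    rw [hf]; ring
  set s : ℝ := Real.sqrt t with hs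
  have hs2 : s ^ 2 = t := Real.sq_sqrt (Nat.cast_nonneg t)
  have hs1 : 1 ≤ s := Real.one_le_sqrt.2 (by exact_mod_cast ht1)
  have hm : G.minDegree * s ≤ 6 * G.edgeFinset.card := by
    refine le_of_sq_le_sq ?_ (by positivity)
    rw [le_div_iff₀ (by positivity)] at ht2
    rw [mul_pow, hs2]
    linarith
  have hmass := mass_lower_bound hG hf0 (sub_self μ) hsub hsource
  have hsum0 : 0 ≤ ∑ u, (G.degree u : ℝ) * f u :=
    Finset.sum_nonneg fun u _ => mul_nonneg (Nat.cast_nonneg _) (hf0 u)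
  have hHx : green (lazyP G) t x x = f x + μ := by rw [hf]; ring
  rw [hHx]
  by_contra! hlt
  clear_value f s μ
  generalize (G.minDegree : ℝ) = d at *
  generalize (G.degree x : ℝ) = D at *
  generalize (G.edgeFinset.card : ℝ) = m at *
  generalize f x = F at *
  generalize ∑ u, (G.degree u : ℝ) * f u = S at *
  set a : ℝ := 6 * D * s / d with ha
  have hD0 : 0 < D := hd0.trans_le hdD
  have had : a * d = 6 * D * s := by rw [ha]; field_simp
  have ha6 : 6 ≤ a := by
    rw [ha, le_div_iff₀ hd0]
    nlinarith
  have hvolμ : d * s * μ ≤ 6 * m * μ := by gcongr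
  have hineq : S + d * s * μ / 3 ≤ s ^ 2 * D := by rw [hs2]; linarith
  have hF : 8 / 3 ≤ F := by
    by_contra! hF
    have h1 : a / 2 < μ := by linarith
    have h2 : d * s * (a / 2) < d * s * μ := by gcongr
    nlinarith
  have h1 := hmass hF
  rw [div_le_iff₀ (by positivity)] at h1
  have h2 : d ^ 2 * F ^ 2 + 24 * D * (d * s * μ / 3) ≤ 24 * D * (s ^ 2 * D) := by
    nlinarith
  have h3 : 24 * D * (s ^ 2 * D) = d ^ 2 * (2 / 3 * a ^ 2) := by
    linear_combination (-2 / 3) * (a * d + 6 * D * s) * had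
  have h4 : 24 * D * (d * s * μ / 3) = d ^ 2 * (4 / 3 * a * μ) := by
    linear_combination (-4 / 3) * d * μ * had
  rw [h3, h4, ← mul_add] at h2
  have h5 := le_of_mul_le_mul_left h2 (by positivity)
  nlinarith [sq_nonneg (F - 2 / 3 * a)]
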